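/- Define the RPST distribution P_RPS(n|N) = P(N,n)·(F(n)−1) / Σ_{i=1}^{N}[P(N,i)·(F(i)−1)] for 1 ≤ n ≤ N. Then for every fixed integer k ≥ 1, lim_{N→∞} P_RPS(N−k | N) = 0. -/

import Mathlib

/-- P(n,i) = n!/(n−i)!, the number of i-permutations of n (the division is exact for i ≤ n). -/
def P (n i : ℕ) : ℕ := n.factorial / (n - i).factorial

/-- F(i) = Σ_{j=0}^{i} P(i,j), the total number of permutation events over i elements. -/
def F (i : ℕ) : ℕ := ∑ j ∈ Finset.range (i + 1), P i j

/-- The RPST distribution: P_RPS(n|N) = P(N,n)·(F(n)−1) / Σ_{i=1}^{N}[P(N,i)·(F(i)−1)]. -/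
noncomputable def P_RPS (n N : ℕ) : ℝ :=
  ((P N n * (F n - 1) : ℕ) : ℝ) / ((∑ i ∈ Finset.Icc 1 N, P N i * (F i - 1) : ℕ) : ℝ)

lemma P_eq_descFactorial {n i : ℕ} (h : i ≤ n) : P n i = n.descFactorial i :=
  (Nat.descFactorial_eq_div h).symm

lemma F_succ (m : ℕ) : F (m + 1) = (m + 1) * F m + 1 := by
  unfold F
  rw [Finset.sum_range_succ', Finset.mul_sum]
  congr 1
  · refine Finset.sum_congr rfl fun j hj => ?_
    have hj' : j ≤ m := by
      have := Finset.mem_range.mp hj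
      omega
    rw [P_eq_descFactorial (by omega), P_eq_descFactorial hj', Nat.succ_descFactorial_succ]
  · rw [P_eq_descFactorial (by omega), Nat.descFactorial_zero]

lemma F_mono : Monotone F := by
  refine monotone_nat_of_le_succ fun m => ?_
  rw [F_succ]
  nlinarith [Nat.zero_le (m * F m)]

lemma F_pos (m : ℕ) : 1 ≤ F m := by
  cases m with
  | zero => simp [F, P]
  | succ m => rw [F_succ]; omega

lemma P_RPS_le (k N : ℕ) (hk : 1 ≤ k) (hN : 1 ≤ N) : P_RPS (N - k) N ≤ 1 / (N : ℝ) := by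
  obtain ⟨m, rfl⟩ : ∃ m, N = m + 1 := ⟨N - 1, by omega⟩
  have hF : F (m + 1 - k) ≤ F m := F_mono (by omega)
  have hPP : P (m + 1) (m + 1) = (m + 1).factorial := by simp [P]
  have h1 : P (m + 1) (m + 1 - k) * (F (m + 1 - k) - 1) ≤ (m + 1).factorial * F m :=
    Nat.mul_le_mul (Nat.div_le_self _ _) ((Nat.sub_le _ _).trans hF)
  have h2 : (m + 1).factorial * ((m + 1) * F m)
      ≤ ∑ i ∈ Finset.Icc 1 (m + 1), P (m + 1) i * (F i - 1) := by
    have h3 := Finset.single_le_sum (f := fun i => P (m + 1) i * (F i - 1))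
      (s := Finset.Icc 1 (m + 1)) (fun i _ => Nat.zero_le _)
      (Finset.mem_Icc.mpr ⟨by omega, le_refl (m + 1)⟩)
    simpa [hPP, F_succ] using h3
  have hpos : 0 < (m + 1).factorial * ((m + 1) * F m) :=
    Nat.mul_pos (Nat.factorial_pos _) (Nat.mul_pos (Nat.succ_pos _) (F_pos m))
  unfold P_RPS
  rw [div_le_div_iff₀ (by exact_mod_cast hpos.trans_le h2) (by positivity)]
  have h4 : P (m + 1) (m + 1 - k) * (F (m + 1 - k) - 1) * (m + 1)
      ≤ 1 * ∑ i ∈ Finset.Icc 1 (m + 1), P (m + 1) i * (F i - 1) := by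
    calc _ ≤ (m + 1).factorial * F m * (m + 1) := Nat.mul_le_mul_right _ h1
      _ = (m + 1).factorial * ((m + 1) * F m) := by ring
      _ ≤ _ := by rw [one_mul]; exact h2
  exact_mod_cast h4

/-- For every fixed integer k ≥ 1, lim_{N→∞} P_RPS(N−k | N) = 0. -/
theorem limit_P_RPS_shorter_length (k : ℕ) (hk : 1 ≤ k) :
    Filter.Tendsto (fun N : ℕ => P_RPS (N - k) N) Filter.atTop (nhds 0) := by
  refine squeeze_zero' (g := fun N : ℕ => 1 / (N : ℝ)) ?_ ?_ tendsto_one_div_atTop_nhds_zero_nat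
  · exact Filter.Eventually.of_forall fun N => div_nonneg (Nat.cast_nonneg _) (Nat.cast_nonneg _)
  · filter_upwards [Filter.eventually_ge_atTop 1] with N hN
    exact P_RPS_le k N hk hN
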